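/- Let H : ℝ → M_{2n}(ℂ) be continuous with H(t) symmetric for all t, and let S : ℝ → M_{2n}(ℂ) be differentiable with Ṡ(t) = ΩH(t)S(t) and S(0) = I. Then for all t, d/dt [ (i/2) S(t)ᵀ Ω \overline{S(t)} ] = − S(t)ᵀ (Im H(t)) \overline{S(t)}. In particular, if Im H(t) is negative semidefinite for all t ≥ 0 and L ⊆ ℂ²ⁿ is a positive Lagrangian subspace, then for every t ≥ 0 and every nonzero z ∈ L one has (i/2)(S(t)z)·Ω \overline{S(t)z} ≥ (i/2) z·Ω z̄ > 0, so S(t)L is a positive Lagrangian subspace for all t ≥ 0. -/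

import Mathlib

open Matrix

noncomputable section

/-- The standard symplectic matrix `Ω = [[0, −I],[I, 0]]` on `ℝ²ⁿ`. -/
def Omg (n : ℕ) : Matrix (Fin n ⊕ Fin n) (Fin n ⊕ Fin n) ℝ :=
  fromBlocks 0 (-1) 1 0

/-- The complexification of `Ω`. -/
def OmgC (n : ℕ) : Matrix (Fin n ⊕ Fin n) (Fin n ⊕ Fin n) ℂ :=
  (Omg n).map Complex.ofReal

/-- Componentwise imaginary part of a complex matrix. -/
def matIm {m k : Type*} (A : Matrix m k ℂ) : Matrix m k ℝ := A.map Complex.im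

/-- Componentwise complex conjugate of a complex matrix. -/
def matConj {m k : Type*} (A : Matrix m k ℂ) : Matrix m k ℂ := A.map (starRingEnd ℂ)

/-- The hermitian form `h(z,z) = (i/2) z·Ω z̄` measuring positivity of Lagrangian
subspaces (the bar is componentwise complex conjugation). -/
def posform {n : ℕ} (z : Fin n ⊕ Fin n → ℂ) : ℂ :=
  (Complex.I / 2) * (z ⬝ᵥ OmgC n *ᵥ star z)

/-- Entrywise product rule for matrix-valued functions of a real variable. -/
theorem hasDerivAt_matrix_mul_apply {l m k : Type*} [Fintype m]
    {A : ℝ → Matrix l m ℂ} {B : ℝ → Matrix m k ℂ} {A' : Matrix l m ℂ} {B' : Matrix m k ℂ} {t : ℝ}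
    (hA : ∀ i j, HasDerivAt (fun s => A s i j) (A' i j) t)
    (hB : ∀ i j, HasDerivAt (fun s => B s i j) (B' i j) t) (i : l) (j : k) :
    HasDerivAt (fun s => (A s * B s) i j) ((A' * B t + A t * B') i j) t := by
  simp only [Matrix.add_apply, Matrix.mul_apply, ← Finset.sum_add_distrib]
  exact HasDerivAt.fun_sum fun p _ => (hA i p).mul (hB p j)

theorem matConj_mul {l m k : Type*} [Fintype m] (A : Matrix l m ℂ) (B : Matrix m k ℂ) :
    matConj (A * B) = matConj A * matConj B :=
  Matrix.map_mul

theorem matConj_OmgC (n : ℕ) : matConj (OmgC n) = OmgC n := by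
  ext i j
  simp [matConj, OmgC]

theorem OmgC_eq_fromBlocks (n : ℕ) : OmgC n = fromBlocks 0 (-1) 1 0 := by
  ext (i | i) (j | j) <;> simp [OmgC, Omg, Matrix.one_apply, apply_ite Complex.ofReal]

theorem OmgC_mul_self (n : ℕ) : OmgC n * OmgC n = -1 := by
  rw [OmgC_eq_fromBlocks, fromBlocks_multiply, ← fromBlocks_one, fromBlocks_neg]
  simp

theorem OmgC_transpose (n : ℕ) : (OmgC n)ᵀ = -OmgC n := by
  rw [OmgC_eq_fromBlocks, fromBlocks_transpose, fromBlocks_neg]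
  simp

theorem sub_matConj {m k : Type*} (A : Matrix m k ℂ) :
    (Complex.I / 2) • (A - matConj A) = -(matIm A).map Complex.ofReal := by
  ext i j
  apply Complex.ext
  · simp [matConj, matIm]
    ring
  · simp [matConj, matIm]

theorem posform_im {n : ℕ} (z : Fin n ⊕ Fin n → ℂ) : (posform z).im = 0 := by
  have h : (z ⬝ᵥ OmgC n *ᵥ star z).re = 0 := by
    simp only [OmgC_eq_fromBlocks, fromBlocks_mulVec, dotProduct, Fintype.sum_sum_type,
      Complex.add_re, Complex.re_sum, ← Finset.sum_add_distrib]
    refine Finset.sum_eq_zero fun i _ => ?_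
    simp [neg_mulVec]
    ring
  simp [posform, h]

theorem star_mulVec_eq {m k : Type*} [Fintype k] (A : Matrix m k ℂ) (z : k → ℂ) :
    star (A *ᵥ z) = matConj A *ᵥ star z := by
  ext i
  simp [mulVec, dotProduct, matConj]

theorem dotProduct_transpose_mulVec_mulVec {m : Type*} [Fintype m] (A B C : Matrix m m ℂ)
    (z w : m → ℂ) :
    z ⬝ᵥ (Aᵀ * B * C) *ᵥ w = (A *ᵥ z) ⬝ᵥ B *ᵥ (C *ᵥ w) := by
  rw [← mulVec_mulVec, ← mulVec_mulVec, dotProduct_mulVec, vecMul_transpose]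

theorem posform_mulVec {n : ℕ} (S : Matrix (Fin n ⊕ Fin n) (Fin n ⊕ Fin n) ℂ)
    (z : Fin n ⊕ Fin n → ℂ) :
    posform (S *ᵥ z) =
      z ⬝ᵥ ((Complex.I / 2) • (Sᵀ * OmgC n * matConj S)) *ᵥ star z := by
  rw [posform, star_mulVec_eq, smul_mulVec, dotProduct_smul, smul_eq_mul,
    dotProduct_transpose_mulVec_mulVec]

theorem Matrix.PosSemidef.re_dotProduct_map_ofReal_nonneg {m : Type*} [Fintype m] {M : Matrix m m ℝ}
    (hM : M.PosSemidef) (w : m → ℂ) : 0 ≤ (w ⬝ᵥ M.map Complex.ofReal *ᵥ star w).re := by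
  have hre := hM.dotProduct_mulVec_nonneg fun i => (w i).re
  have him := hM.dotProduct_mulVec_nonneg fun i => (w i).im
  refine (add_nonneg hre him).trans_eq ?_
  simp only [dotProduct, mulVec, Finset.mul_sum, Complex.re_sum, ← Finset.sum_add_distrib]
  refine Finset.sum_congr rfl fun i _ => Finset.sum_congr rfl fun j _ => ?_
  simp

theorem hasDerivAt_dotProduct_mulVec {m : Type*} [Fintype m] {Q : ℝ → Matrix m m ℂ}
    {Q' : Matrix m m ℂ} {t : ℝ} (hQ : ∀ i j, HasDerivAt (fun s => Q s i j) (Q' i j) t)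
    (v w : m → ℂ) : HasDerivAt (fun s => v ⬝ᵥ Q s *ᵥ w) (v ⬝ᵥ Q' *ᵥ w) t :=
  HasDerivAt.fun_sum fun i _ =>
    (HasDerivAt.fun_sum fun j _ => (hQ i j).mul_const (w j)).const_mul (v i)

/-- Let `H : ℝ → M_{2n}(ℂ)` be continuous and symmetric-valued, and
let `S` solve `Ṡ = ΩHS`, `S(0) = I`. Then
`d/dt [(i/2) SᵀΩS̄] = −Sᵀ(Im H)S̄` for all `t`. In particular, if `Im H(t) ≤ 0` for all
`t ≥ 0` and `L` is a positive Lagrangian subspace, then for `t ≥ 0` and nonzero `z ∈ L`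
one has `(i/2)(S(t)z)·Ω(S(t)z)‾ ≥ (i/2) z·Ω z̄ > 0`, so `S(t)L` is positive. -/
theorem statement10 (n : ℕ) (H S : ℝ → Matrix (Fin n ⊕ Fin n) (Fin n ⊕ Fin n) ℂ)
    (hHcont : ∀ i j, Continuous fun t => H t i j)
    (hHsymm : ∀ t, (H t)ᵀ = H t)
    (hS : ∀ t, ∀ i j, HasDerivAt (fun s => S s i j) ((OmgC n * H t * S t) i j) t)
    (hS0 : S 0 = 1) :
    (∀ t, ∀ i j,
      HasDerivAt (fun s => ((Complex.I / 2) • ((S s)ᵀ * OmgC n * matConj (S s))) i j)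
        ((-((S t)ᵀ * ((matIm (H t)).map Complex.ofReal) * matConj (S t))) i j) t) ∧
    ((∀ t, 0 ≤ t → (-(matIm (H t))).PosSemidef) →
      ∀ L : Submodule ℂ (Fin n ⊕ Fin n → ℂ),
        Module.finrank ℂ L = n →
        (∀ z ∈ L, ∀ z' ∈ L, z ⬝ᵥ OmgC n *ᵥ z' = 0) →
        (∀ z ∈ L, z ≠ 0 → (posform z).im = 0 ∧ 0 < (posform z).re) →
        ∀ t, 0 ≤ t → ∀ z ∈ L, z ≠ 0 →
          0 < (posform z).re ∧ (posform z).re ≤ (posform (S t *ᵥ z)).re ∧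
            (posform (S t *ᵥ z)).im = 0) := by
  have hQ : ∀ t, ∀ i j,
      HasDerivAt (fun s => ((Complex.I / 2) • ((S s)ᵀ * OmgC n * matConj (S s))) i j)
        ((-((S t)ᵀ * ((matIm (H t)).map Complex.ofReal) * matConj (S t))) i j) t := by
    intro t i j
    have hT : ∀ i j, HasDerivAt (fun s => (S s)ᵀ i j) ((OmgC n * H t * S t)ᵀ i j) t :=
      fun i j => hS t j i
    have hΩ : ∀ i j, HasDerivAt (fun _ : ℝ => OmgC n i j)
        ((0 : Matrix (Fin n ⊕ Fin n) (Fin n ⊕ Fin n) ℂ) i j) t :=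
      fun i j => hasDerivAt_const t _
    have hC : ∀ i j, HasDerivAt (fun s => matConj (S s) i j)
        (matConj (OmgC n * H t * S t) i j) t :=
      fun i j => (hS t i j).star
    have key := (hasDerivAt_matrix_mul_apply (hasDerivAt_matrix_mul_apply hT hΩ) hC i j).const_mul
      (Complex.I / 2)
    have e : (Complex.I / 2) • (((OmgC n * H t * S t)ᵀ * OmgC n + (S t)ᵀ * 0) * matConj (S t) +
        (S t)ᵀ * OmgC n * matConj (OmgC n * H t * S t)) =
        -((S t)ᵀ * ((matIm (H t)).map Complex.ofReal) * matConj (S t)) := by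
      have h₁ : (OmgC n * H t * S t)ᵀ * OmgC n = (S t)ᵀ * H t := by
        rw [transpose_mul, transpose_mul, hHsymm, OmgC_transpose, Matrix.mul_assoc,
          Matrix.mul_assoc (H t), Matrix.neg_mul, OmgC_mul_self, neg_neg, Matrix.mul_one]
      have h₂ : (S t)ᵀ * OmgC n * matConj (OmgC n * H t * S t) =
          -((S t)ᵀ * matConj (H t) * matConj (S t)) := by
        rw [matConj_mul, matConj_mul, matConj_OmgC, Matrix.mul_assoc (OmgC n), Matrix.mul_assoc,
          ← Matrix.mul_assoc (OmgC n), OmgC_mul_self]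
        simp [Matrix.mul_assoc]
      rw [h₁, h₂, Matrix.mul_zero, add_zero, ← sub_eq_add_neg, ← Matrix.sub_mul, ← Matrix.mul_sub,
        ← Matrix.smul_mul, ← Matrix.mul_smul, sub_matConj, Matrix.mul_neg, Matrix.neg_mul]
    rw [← e]
    exact key
  refine ⟨hQ, fun hH L _ _ hpos t ht z hz hz0 => ⟨(hpos z hz hz0).2, ?_, posform_im _⟩⟩
  have hd : ∀ s, HasDerivAt (fun s => (posform (S s *ᵥ z)).re)
      ((S s *ᵥ z) ⬝ᵥ (-matIm (H s)).map Complex.ofReal *ᵥ star (S s *ᵥ z)).re s := by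
    intro s
    have h := hasDerivAt_dotProduct_mulVec (hQ s) z (star z)
    simp only [← posform_mulVec] at h
    refine (Complex.reCLM.hasFDerivAt.comp_hasDerivAt s h).congr_deriv ?_
    have hneg : (-matIm (H s)).map Complex.ofReal = -(matIm (H s)).map Complex.ofReal := by
      ext; simp
    rw [hneg, star_mulVec_eq, ← dotProduct_transpose_mulVec_mulVec, Matrix.mul_neg, Matrix.neg_mul]
    rfl
  have hmono : MonotoneOn (fun s => (posform (S s *ᵥ z)).re) (Set.Ici 0) := by
    refine monotoneOn_of_deriv_nonneg (convex_Ici 0)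
      (fun s _ => (hd s).continuousAt.continuousWithinAt)
      (fun s _ => (hd s).differentiableAt.differentiableWithinAt) fun s hs => ?_
    rw [(hd s).deriv]
    rw [interior_Ici] at hs
    exact (hH s (le_of_lt hs)).re_dotProduct_map_ofReal_nonneg _
  simpa [hS0] using hmono Set.self_mem_Ici ht ht
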